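/- Let p, q ∈ [1,∞] satisfy 1/p + 1/q = 1, let μ be a measure on a measurable space α, let n ≥ 1, and let f_1,…,f_n, g_1,…,g_n : α → ℝ be measurable with ‖f_i‖_{L^p(μ)} < ∞ and ‖g_i‖_{L^q(μ)} < ∞ for all i. Then there is a constant C depending only on n such that |∫ ∑_{i=1}^n f_i(x)·g_i(x) dμ(x)| ≤ C · ‖x ↦ ‖y ↦ ∑_{i=1}^n f_i(x)·g_i(y)‖_{L^q_y(μ)}‖_{L^p_x(μ)} (an improved vector-valued Hölder inequality with pointwise dot products on the right-hand side). -/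

import Mathlib

open MeasureTheory ENNReal

universe u

/-- Auerbach's lemma for real finite-dimensional normed spaces. -/
theorem auerbach_aux (V : Type*) [NormedAddCommGroup V] [NormedSpace ℝ V]
    [FiniteDimensional ℝ V] :
    ∃ e : Module.Basis (Fin (Module.finrank ℝ V)) ℝ V,
      (∀ j, ‖e j‖ ≤ 1) ∧ ∀ j v, |e.coord j v| ≤ ‖v‖ := by
  classical
  have : ProperSpace V := FiniteDimensional.proper ℝ V
  set b := Module.finBasis ℝ V with hb
  have hcont : Continuous (fun v : Fin (Module.finrank ℝ V) → V => |b.det v|) := by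
    refine Continuous.abs ?_
    change Continuous (fun v => Matrix.det (b.toMatrix v))
    refine Continuous.matrix_det ?_
    refine continuous_matrix fun i j => ?_
    have h1 : Continuous (b.coord i) := LinearMap.continuous_of_finiteDimensional _
    exact h1.comp (continuous_apply j)
  have hK : IsCompact (Set.pi Set.univ
      (fun _ : Fin (Module.finrank ℝ V) => Metric.closedBall (0 : V) 1)) :=
    isCompact_univ_pi fun _ => isCompact_closedBall _ _
  obtain ⟨v, hvK, hv⟩ := hK.exists_isMaxOn ⟨0, by simp⟩ hcont.continuousOn
  have hvK' : ∀ j, ‖v j‖ ≤ 1 := by simpa using hvK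
  have hmax : ∀ w : Fin (Module.finrank ℝ V) → V, (∀ j, ‖w j‖ ≤ 1) →
      |b.det w| ≤ |b.det v| := by
    intro w hw
    exact hv (by simpa using hw)
  have hne : b.det v ≠ 0 := by
    have h0 : ∀ j, ‖b j‖ ≠ 0 := fun j => norm_ne_zero_iff.2 (b.ne_zero j)
    have h1 := hmax (fun j => (‖b j‖)⁻¹ • b j) (by
      intro j
      rw [norm_smul, norm_inv, norm_norm, inv_mul_cancel₀ (h0 j)])
    rw [AlternatingMap.map_smul_univ, b.det_self] at h1
    intro h2
    rw [h2, abs_zero] at h1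
    have h3 := abs_nonpos_iff.1 h1
    rw [smul_eq_mul, mul_one, Finset.prod_eq_zero_iff] at h3
    obtain ⟨j, -, hj⟩ := h3
    exact h0 j (inv_eq_zero.1 hj)
  obtain ⟨hli, hsp⟩ := (Module.Basis.is_basis_iff_det b).2 (isUnit_iff_ne_zero.2 hne)
  refine ⟨Module.Basis.mk hli hsp.ge, fun j => by simpa using hvK' j, ?_⟩
  intro j w
  have key : ∀ u : V, ‖u‖ ≤ 1 → |(Module.Basis.mk hli hsp.ge).coord j u| ≤ 1 := by
    intro u hu
    have h1 := congrArg (fun L => L u)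
      (b.det_smul_mk_coord_eq_det_update hli hsp.ge j)
    simp only [LinearMap.smul_apply, smul_eq_mul, MultilinearMap.toLinearMap_apply] at h1
    have h2 := hmax (Function.update v j u) (by
      intro k
      by_cases hk : k = j
      · subst hk; simpa using hu
      · simpa [hk] using hvK' k)
    have h3 : b.det v * (Module.Basis.mk hli hsp.ge).coord j u
      = b.det (Function.update v j u) := h1
    rw [← h3, abs_mul] at h2
    have hpos : 0 < |b.det v| := abs_pos.2 hne
    nlinarith
  by_cases hw : w = 0
  · rw [hw, map_zero, abs_zero, norm_zero]
  have hw' : 0 < ‖w‖ := norm_pos_iff.2 hw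
  have := key (‖w‖⁻¹ • w) (by rw [norm_smul, norm_inv, norm_norm, inv_mul_cancel₀ hw'.ne'])
  rw [map_smul, smul_eq_mul, abs_mul, abs_inv, abs_norm, inv_mul_le_iff₀ hw', mul_one] at this
  exact this

theorem auerbach_family {W : Type*} [NormedAddCommGroup W] [NormedSpace ℝ W] (n : ℕ)
    (G : Fin n → W) :
    ∃ (m : ℕ) (e : Fin m → W) (c : Fin m → Fin n → ℝ), m ≤ n ∧ (∀ j, ‖e j‖ ≤ 1) ∧
      (∀ i, G i = ∑ j, c j i • e j) ∧
      ∀ j (a : Fin n → ℝ), |∑ i, a i * c j i| ≤ ‖∑ i, a i • G i‖ := by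
  let V : Submodule ℝ W := Submodule.span ℝ (Set.range G)
  have : FiniteDimensional ℝ V := FiniteDimensional.span_of_finite ℝ (Set.finite_range G)
  have hdim : Module.finrank ℝ V ≤ n := by
    have := finrank_range_le_card (R := ℝ) G
    rw [Fintype.card_fin] at this
    exact this
  obtain ⟨e, he1, he2⟩ := auerbach_aux V
  let G' : Fin n → V := fun i => ⟨G i, Submodule.subset_span ⟨i, rfl⟩⟩
  refine ⟨Module.finrank ℝ V, fun j => (e j : W), fun j i => e.coord j (G' i), hdim,
    fun j => he1 j, fun i => ?_, fun j a => ?_⟩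
  · have := congrArg V.subtype (e.sum_repr (G' i)).symm
    rw [map_sum] at this
    exact this
  · have h1 : ‖∑ i, a i • G' i‖ = ‖∑ i, a i • G i‖ := by
      rw [← Submodule.norm_coe]; simp [G']
    have := he2 j (∑ i, a i • G' i)
    rw [h1] at this
    simpa only [map_sum, map_smul, smul_eq_mul] using this

/-- **Improved vector-valued Hölder inequality** for conjugate exponents `1/p + 1/q = 1`:
the integral of the pointwise dot product `∑ f i x * g i x` is controlled, up to a constant
depending only on `n`, by the iterated `L^p_x(L^q_y)` norm of `(x,y) ↦ ∑ f i x * g i y`. -/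
theorem stmt3 (n : ℕ) (hn : 1 ≤ n) :
    ∃ C : ℝ, 0 < C ∧
      ∀ (α : Type u) [MeasurableSpace α] (μ : Measure α) (p q : ℝ≥0∞),
        1 ≤ p → 1 ≤ q → 1 / p + 1 / q = 1 →
        ∀ f g : Fin n → α → ℝ,
          (∀ i, Measurable (f i)) → (∀ i, Measurable (g i)) →
          (∀ i, eLpNorm (f i) p μ < ⊤) → (∀ i, eLpNorm (g i) q μ < ⊤) →
          |∫ x, ∑ i, f i x * g i x ∂μ| ≤
            C * (eLpNorm (fun x =>
              (eLpNorm (fun y => ∑ i, f i x * g i y) q μ).toReal) p μ).toReal := by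
  refine ⟨n, by exact_mod_cast hn, ?_⟩
  intro α _ μ p q hp hq hpq f g hfm hgm hf hg
  have : Fact (1 ≤ q) := ⟨hq⟩
  have : ENNReal.HolderConjugate p q := ENNReal.holderConjugate_iff.2 (by simpa using hpq)
  have hfL : ∀ i, MemLp (f i) p μ := fun i => ⟨(hfm i).aestronglyMeasurable, hf i⟩
  have hgL : ∀ i, MemLp (g i) q μ := fun i => ⟨(hgm i).aestronglyMeasurable, hg i⟩
  let G : Fin n → Lp ℝ q μ := fun i => (hgL i).toLp (g i)
  obtain ⟨m, e, c, hdim, he1, hG, he2⟩ := auerbach_family n G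
  set N : α → ℝ := fun x => (eLpNorm (fun y => ∑ i, f i x * g i y) q μ).toReal with hN
  have hNx : ∀ x, N x = ‖∑ i, f i x • G i‖ := by
    intro x
    rw [Lp.norm_def]
    refine congrArg ENNReal.toReal ?_
    refine eLpNorm_congr_ae ?_
    have h2 : ∀ᵐ y ∂μ, ∀ i, (f i x • G i : Lp ℝ q μ) y = f i x * g i y := by
      rw [ae_all_iff]
      intro i
      filter_upwards [Lp.coeFn_smul (f i x) (G i), (hgL i).coeFn_toLp] with y h3 h4
      rw [h3, Pi.smul_apply, smul_eq_mul, h4]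
    filter_upwards [h2, Lp.coeFn_fun_finsetSum Finset.univ (fun i => f i x • G i)] with y h3 h4
    rw [h4]
    exact Finset.sum_congr rfl fun i _ => (h3 i).symm
  let F : Fin (m) → α → ℝ := fun j x => ∑ i, f i x * c j i
  have hFN : ∀ j x, ‖F j x‖ ≤ N x := by
    intro j x
    rw [hNx, Real.norm_eq_abs]
    exact he2 j fun i => f i x
  have hFL : ∀ j, MemLp (F j) p μ := by
    intro j
    exact memLp_finsetSum _ fun i _ => (hfL i).mul_const _
  have hNfin : eLpNorm N p μ ≠ ⊤ := by
    have h1 : MemLp (fun x => ∑ i, ‖f i x‖ * ‖G i‖) p μ :=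
      memLp_finsetSum _ fun i _ => (hfL i).norm.mul_const _
    refine ((eLpNorm_mono_real fun x => ?_).trans_lt h1.2).ne
    rw [hNx, norm_norm]
    exact (norm_sum_le _ _).trans (Finset.sum_le_sum fun i _ => (norm_smul _ _).le)
  let E : Fin (m) → α → ℝ := fun j => e j
  have hEL : ∀ j, MemLp (E j) q μ := fun j => Lp.memLp _
  have hint : ∀ j, Integrable (fun x => F j x * E j x) μ := fun j =>
    (hFL j).integrable_mul (hEL j)
  have hexp : ∀ᵐ x ∂μ, ∀ i, g i x = ∑ j, c j i * E j x := by
    rw [ae_all_iff]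
    intro i
    have h2 : ∀ᵐ y ∂μ, ∀ j, (c j i • e j : Lp ℝ q μ) y
        = c j i * E j y := by
      rw [ae_all_iff]
      intro j
      filter_upwards [Lp.coeFn_smul (c j i) (e j)] with y h3
      rw [h3, Pi.smul_apply, smul_eq_mul]
    filter_upwards [h2, (hgL i).coeFn_toLp, Lp.coeFn_fun_finsetSum Finset.univ
      (fun j => c j i • e j)] with y h3 h4 h5
    rw [← h4]
    change (G i : α → ℝ) y = _
    rw [hG i, h5]
    exact Finset.sum_congr rfl fun j _ => h3 j
  have hI : ∫ x, ∑ i, f i x * g i x ∂μ = ∑ j, ∫ x, F j x * E j x ∂μ := by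
    rw [← integral_finsetSum _ fun j _ => hint j]
    refine integral_congr_ae ?_
    filter_upwards [hexp] with x hx
    simp only [F, Finset.sum_mul]
    rw [Finset.sum_comm]
    refine Finset.sum_congr rfl fun i _ => ?_
    rw [hx i, Finset.mul_sum]
    exact Finset.sum_congr rfl fun j _ => by ring
  have hj : ∀ j, |∫ x, F j x * E j x ∂μ| ≤ (eLpNorm N p μ).toReal := by
    intro j
    have hE1 : eLpNorm (E j) q μ ≤ 1 := by
      have h1 : (eLpNorm (E j) q μ).toReal ≤ 1 := he1 j
      rw [← ENNReal.toReal_one] at h1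
      exact (ENNReal.toReal_le_toReal (hEL j).2.ne ENNReal.one_ne_top).1 h1
    have h2 : eLpNorm (F j • E j) 1 μ ≤ eLpNorm N p μ := by
      refine (eLpNorm_smul_le_mul_eLpNorm (p := p) (q := q) (hEL j).1 (hFL j).1).trans ?_
      calc _ ≤ eLpNorm N p μ * 1 := mul_le_mul' (eLpNorm_mono_real (hFN j)) hE1
        _ = _ := mul_one _
    rw [← Real.norm_eq_abs, ← toReal_enorm]
    refine ENNReal.toReal_mono hNfin (le_trans ?_ h2)
    rw [eLpNorm_one_eq_lintegral_enorm]
    exact enorm_integral_le_lintegral_enorm _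
  rw [hI]
  calc |∑ j, ∫ x, F j x * E j x ∂μ| ≤ ∑ j, |∫ x, F j x * E j x ∂μ| :=
        Finset.abs_sum_le_sum_abs _ _
    _ ≤ ∑ _j : Fin (m), (eLpNorm N p μ).toReal :=
        Finset.sum_le_sum fun j _ => hj j
    _ = (m : ℝ) * (eLpNorm N p μ).toReal := by simp
    _ ≤ n * (eLpNorm N p μ).toReal := by
        gcongr
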